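/- Let G = {{1,j} : 2 ≤ j ≤ 11} ∪ {{2,3},{2,4}} be a family of subsets of {1,…,11} and let P = {A ⊆ {1,…,11} : g ⊆ A for some g ∈ G} (the set of supports of squarefree monomials in the squarefree lex ideal L₂^σ = (x₁x₂, x₁x₃, …, x₁x₁₁, x₂x₃, x₂x₄) ⊂ K[x₁,…,x₁₁]). Then there is no finite family of pairs (B_j, C_j) with B_j ⊆ C_j, B_j ∈ P, C_j ∈ P and |C_j| ≥ 7 for all j, such that the intervals {A : B_j ⊆ A ⊆ C_j} are pairwise disjoint and their union is all of P. (By the Herzog–Vladoiu–Zheng criterion this says sdepth(L₂^σ) ≤ 6, so sdepth(L₂^σ) = 6 < hdepth(L₂^σ) = 7; Counterexample 3.4.) -/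

import Mathlib

/-- The generators of the squarefree lex ideal
`L₂^σ = (x₁x₂, x₁x₃, …, x₁x₁₁, x₂x₃, x₂x₄) ⊂ K[x₁,…,x₁₁]`, as subsets of `{1,…,11}`
(here `Fin 11`, zero-indexed). -/
def stmt18G : Finset (Finset (Fin 11)) :=
  {{0, 1}, {0, 2}, {0, 3}, {0, 4}, {0, 5}, {0, 6}, {0, 7}, {0, 8}, {0, 9}, {0, 10},
    {1, 2}, {1, 3}}

/-- On a finite set `N`, an asymmetric relation `x ∈ C j` in which every `j` has at least `k`
out-neighbours other than itself satisfies `2 * k * |N| ≤ |N| * (|N| - 1)`. -/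
theorem Finset.two_mul_card_mul_le_card_offDiag {α : Type*} [DecidableEq α] (N : Finset α)
    (C : α → Finset α) (k : ℕ) (hk : ∀ j ∈ N, k ≤ ((N.erase j) ∩ C j).card)
    (hC : ∀ j ∈ N, ∀ x ∈ N, j ≠ x → x ∈ C j → j ∉ C x) :
    2 * (N.card * k) ≤ N.offDiag.card := by
  let E : Finset (α × α) := N.offDiag.filter fun q => q.2 ∈ C q.1
  have hE : N.card * k ≤ E.card := by
    rw [Finset.card_eq_sum_card_fiberwise (f := Prod.fst) (t := N)
      (fun q hq => (Finset.mem_offDiag.1 (Finset.mem_filter.1 hq).1).1)]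
    rw [← smul_eq_mul]
    refine Finset.card_nsmul_le_sum _ _ _ fun j hj => (hk j hj).trans ?_
    refine Finset.card_le_card_of_injOn (fun x => (j, x)) (fun x hx => ?_)
      (fun x _ y _ h => (Prod.mk.inj h).2)
    simp only [Finset.coe_inter, Finset.coe_erase, Set.mem_inter_iff, Set.mem_sdiff,
      Finset.mem_coe, Set.mem_singleton_iff] at hx
    exact Finset.mem_filter.2 ⟨Finset.mem_filter.2 ⟨Finset.mem_offDiag.2
      ⟨hj, hx.1.1, fun h => hx.1.2 h.symm⟩, hx.2⟩, rfl⟩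
  have hdisj : Disjoint E (E.image Prod.swap) := by
    rw [Finset.disjoint_left]
    rintro ⟨j, x⟩ h h'
    obtain ⟨⟨y, z⟩, hyz, h_eq⟩ := Finset.mem_image.1 h'
    obtain ⟨rfl, rfl⟩ := Prod.mk.inj h_eq
    simp only [E, Finset.mem_filter, Finset.mem_offDiag] at h hyz
    exact hC _ h.1.1 _ h.1.2.1 h.1.2.2 h.2 hyz.2
  have hsub : E ∪ E.image Prod.swap ⊆ N.offDiag := by
    refine Finset.union_subset (Finset.filter_subset _ _) fun q hq => ?_
    obtain ⟨r, hr, rfl⟩ := Finset.mem_image.1 hq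
    have h := Finset.mem_offDiag.1 (Finset.mem_filter.1 hr).1
    exact Finset.mem_offDiag.2 ⟨h.2.1, h.1, h.2.2.symm⟩
  have hcard := Finset.card_le_card hsub
  rw [Finset.card_union_of_disjoint hdisj,
    Finset.card_image_of_injective _ Prod.swap_injective] at hcard
  omega

theorem pair_mem_stmt18G : ∀ j : Fin 11, j ≠ 0 → ({0, j} : Finset (Fin 11)) ∈ stmt18G := by
  intro j hj
  fin_cases j <;> simp_all [stmt18G]

theorem card_of_mem_stmt18G : ∀ g ∈ stmt18G, g.card = 2 := by
  simp [stmt18G]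

/-- Counterexample 3.4: the family `P` of supports of squarefree monomials of `L₂^σ`
admits no partition into intervals `[B_j, C_j]` with `B_j, C_j ∈ P` and `|C_j| ≥ 7`;
by the Herzog–Vladoiu–Zheng criterion, `sdepth(L₂^σ) ≤ 6 < hdepth(L₂^σ) = 7`. -/
theorem stmt_18 :
    ¬ ∃ Part : Finset (Finset (Fin 11) × Finset (Fin 11)),
      (∀ p ∈ Part, p.1 ⊆ p.2 ∧ (∃ g ∈ stmt18G, g ⊆ p.1) ∧ (∃ g ∈ stmt18G, g ⊆ p.2) ∧
        7 ≤ p.2.card) ∧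
      (∀ p ∈ Part, ∀ q ∈ Part, p ≠ q →
        ∀ A : Finset (Fin 11), ¬((p.1 ⊆ A ∧ A ⊆ p.2) ∧ (q.1 ⊆ A ∧ A ⊆ q.2))) ∧
      (∀ A : Finset (Fin 11), (∃ g ∈ stmt18G, g ⊆ A) ↔ ∃ p ∈ Part, p.1 ⊆ A ∧ A ⊆ p.2) := by
  rintro ⟨Part, hPart, hdisj, hcover⟩
  have hgen : ∀ j : Fin 11, ∃ C : Finset (Fin 11), j ≠ 0 → (({0, j}, C) ∈ Part) := by
    intro j
    by_cases hj : j = 0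
    · exact ⟨∅, fun h => absurd hj h⟩
    obtain ⟨⟨B, C⟩, hp, hB, -⟩ := (hcover {0, j}).1 ⟨_, pair_mem_stmt18G j hj, subset_rfl⟩
    obtain ⟨-, ⟨g, hg, hgB⟩, -⟩ := hPart _ hp
    have hcard : ({0, j} : Finset (Fin 11)).card ≤ B.card :=
      Finset.card_le_two.trans ((card_of_mem_stmt18G g hg).symm.le.trans (Finset.card_le_card hgB))
    obtain rfl := Finset.eq_of_subset_of_card_le hB hcard
    exact ⟨C, fun _ => hp⟩
  choose C hC using hgen
  have hbound := Finset.two_mul_card_mul_le_card_offDiag (Finset.univ.erase (0 : Fin 11)) C 5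
    (fun j hj => ?_) (fun j hj x hx hjx hxC hjC => ?_)
  · revert hbound
    simp [Finset.offDiag_card]
  · obtain ⟨hsub, -, -, h_seven⟩ := hPart _ (hC j (Finset.ne_of_mem_erase hj))
    dsimp only at hsub h_seven
    have h_eq : (Finset.univ.erase (0 : Fin 11)).erase j ∩ C j = C j \ {0, j} := by
      ext x
      simp
      tauto
    rw [h_eq, Finset.card_sdiff_of_subset hsub]
    have h_two : ({0, j} : Finset (Fin 11)).card ≤ 2 := Finset.card_le_two
    omega
  · have hpj := hC j (Finset.ne_of_mem_erase hj)
    have hpx := hC x (Finset.ne_of_mem_erase hx)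
    have hsj := (hPart _ hpj).1
    have hsx := (hPart _ hpx).1
    simp only [Finset.insert_subset_iff, Finset.singleton_subset_iff] at hsj hsx
    refine hdisj _ hpj _ hpx (fun h => ?_) {0, j, x} ?_
    · have hmem : j ∈ ({0, x} : Finset (Fin 11)) := by
        rw [← (Prod.mk.inj h).1]
        simp
      simp only [Finset.mem_insert, Finset.mem_singleton] at hmem
      exact hmem.elim (Finset.ne_of_mem_erase hj) hjx
    · simp [Finset.insert_subset_iff, hsj, hsx, hxC, hjC]
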